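/- (+2 flow in SO(N+1) is the second complex vector mKdV equation; part of Theorem 4.) Let N ≥ 2 and let v₁, v₂ : ℝ² → ℝ^{N−1} be smooth, with v := v₁ + i·v₂. Define the so(N+1)-valued maps e_x := [[J, 0],[0, 0]], ω_x := [[0, V],[−Vᵀ, 0]] with V having rows v₁, v₂; e_t := [[h∥·J, H],[−Hᵀ, 𝐡⊥]] where h∥ := (1/2)|v|², H is the 2×(N−1) matrix with rows −∂_x v₂ and ∂_x v₁ (complex combination of rows equal to i·∂_x v), and 𝐡⊥ := −Im(v̄⊗v) entrywise; and ω_t := [[θ·J, W],[−Wᵀ, Θ]] where W is the 2×(N−1) matrix whose rows have complex combination ϖ := ∂_x² v + |v|²·v − (1/2)(v·v)·v̄, Θ := Re(v̄⊗(∂_x v)) − Re((∂_x v̄)⊗v) entrywise, and θ := Im(v̄·(∂_x v)). Then the pair of Cartan structure equations — zero torsion ∂_x e_t − ∂_t e_x + [ω_x, e_t] − [ω_t, e_x] = 0 and constant curvature ∂_x ω_t − ∂_t ω_x + [ω_x, ω_t] = −[e_x, e_t] — holds at every point of ℝ² if and only if v satisfies the U(N−1)-invariant complex vector mKdV equation ∂_t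 v = ∂_x³ v + (3/2)(|v|²·∂_x v + ((∂_x v)·v̄)·v − ((∂_x v)·v)·v̄) + ∂_x v. -/

import Mathlib

open Matrix

noncomputable section

/-- Index type for (N+1)×(N+1) matrices, N = n+1, split as {1,2} ⊕ the rest. -/
abbrev Jdx (n : ℕ) := Fin 2 ⊕ Fin n

/-- J = [[0,1],[−1,0]]. -/
def Jm : Matrix (Fin 2) (Fin 2) ℝ := !![0, 1; -1, 0]

/-- E = [[J,0],[0,0]] ∈ so(N+1). -/
def Em (n : ℕ) : Matrix (Jdx n) (Jdx n) ℝ := Matrix.fromBlocks Jm 0 0 0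

/-- The 2×(N−1) matrix with prescribed rows. -/
def row2 {n : ℕ} (a b : Fin n → ℝ) : Matrix (Fin 2) (Fin n) ℝ := Matrix.of ![a, b]

/-- Componentwise complex conjugate of a row vector. -/
def cvec {n : ℕ} (p : Fin n → ℂ) : Fin n → ℂ := fun j => starRingEnd ℂ (p j)

/-- Outer product (p⊗q)_{jk} = p_j·q_k. -/
def outer {n : ℕ} (p q : Fin n → ℂ) : Matrix (Fin n) (Fin n) ℂ :=
  Matrix.of fun j k => p j * q k

/-- Dot product p·q = Σ_j p_j q_j. -/
def dotv {n : ℕ} (p q : Fin n → ℂ) : ℂ := ∑ j, p j * q j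

/-- Contraction (p⌟M)_k = Σ_j p_j M_{jk}. -/
def contr {n : ℕ} (p : Fin n → ℂ) (M : Matrix (Fin n) (Fin n) ℂ) : Fin n → ℂ :=
  fun k => ∑ j, p j * M j k

/-- Entrywise ∂_x of a real-matrix-valued function of (t,x). -/
def dxMR {m k : Type*} (f : ℝ → ℝ → Matrix m k ℝ) (t x : ℝ) : Matrix m k ℝ :=
  Matrix.of fun i j => deriv (fun y => f t y i j) x

/-- Entrywise ∂_t of a real-matrix-valued function of (t,x). -/
def dtMR {m k : Type*} (f : ℝ → ℝ → Matrix m k ℝ) (t x : ℝ) : Matrix m k ℝ :=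
  Matrix.of fun i j => deriv (fun s => f s x i j) t

/-- Componentwise ∂_x of a complex-row-vector-valued function of (t,x). -/
def dxV {n : ℕ} (f : ℝ → ℝ → Fin n → ℂ) (t x : ℝ) : Fin n → ℂ :=
  fun j => deriv (fun y => f t y j) x

/-- Componentwise ∂_t of a complex-row-vector-valued function of (t,x). -/
def dtV {n : ℕ} (f : ℝ → ℝ → Fin n → ℂ) (t x : ℝ) : Fin n → ℂ :=
  fun j => deriv (fun s => f s x j) t

/-- One real component of the `1`-form coefficient `ϖ`, for `v = a + i b` and `a₂ = ∂ₓ²a`. -/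
def reVarpi {n : ℕ} (a b a2 : Fin n → ℝ) : Fin n → ℝ :=
  fun k => a2 k + (1 / 2 * (a ⬝ᵥ a) + 3 / 2 * (b ⬝ᵥ b)) * a k - (a ⬝ᵥ b) * b k

/-- The `x`-derivative of `reVarpi`. -/
def reVarpiDeriv {n : ℕ} (a b a1 b1 a3 : Fin n → ℝ) : Fin n → ℝ :=
  fun k => a3 k + ((a ⬝ᵥ a1) + 3 * (b ⬝ᵥ b1)) * a k
    + (1 / 2 * (a ⬝ᵥ a) + 3 / 2 * (b ⬝ᵥ b)) * a1 k
    - ((a1 ⬝ᵥ b) + (a ⬝ᵥ b1)) * b k - (a ⬝ᵥ b) * b1 k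

/-- One real component of the right-hand side of the complex vector mKdV equation. -/
def mkdvRe {n : ℕ} (a b a1 b1 a3 : Fin n → ℝ) : Fin n → ℝ :=
  fun k => a3 k + 3 / 2 * ((a ⬝ᵥ a) + (b ⬝ᵥ b)) * a1 k
    + 3 * (b ⬝ᵥ b1) * a k - 3 * (a ⬝ᵥ b1) * b k + a1 k

theorem sum_mul_mul_const {n : ℕ} (p q : Fin n → ℝ) (c : ℝ) :
    ∑ x, p x * (q x * c) = (p ⬝ᵥ q) * c := by
  simp only [dotProduct, Finset.sum_mul, mul_assoc]

theorem sum_const_mul_mul {n : ℕ} (p q : Fin n → ℝ) (c : ℝ) :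
    ∑ x, c * p x * q x = c * (p ⬝ᵥ q) := by
  simp only [dotProduct, Finset.mul_sum, mul_assoc]

theorem sum_mul_const_mul {n : ℕ} (p q : Fin n → ℝ) (c : ℝ) :
    ∑ x, p x * (c * q x) = c * (p ⬝ᵥ q) := by
  simp only [dotProduct, Finset.mul_sum, mul_left_comm]

theorem sum_mul_eq_dotProduct {n : ℕ} (p q : Fin n → ℝ) :
    ∑ x, p x * q x = p ⬝ᵥ q := rfl

theorem torsion_algebra {n : ℕ} (a b a1 b1 a2 b2 : Fin n → ℝ) (T : ℝ)
    (S : Matrix (Fin n) (Fin n) ℝ) :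
    fromBlocks (((a ⬝ᵥ a1) + (b ⬝ᵥ b1)) • Jm) (row2 (-b2) a2) (-(row2 (-b2) a2)ᵀ)
        (of fun j k => -(a1 j * b k + a j * b1 k - b1 j * a k - b j * a1 k))
      + (fromBlocks 0 (row2 a b) (-(row2 a b)ᵀ) 0
          * fromBlocks ((1 / 2 * ((a ⬝ᵥ a) + (b ⬝ᵥ b))) • Jm) (row2 (-b1) a1) (-(row2 (-b1) a1)ᵀ)
              (of fun j k => -(a j * b k - b j * a k))
        - fromBlocks ((1 / 2 * ((a ⬝ᵥ a) + (b ⬝ᵥ b))) • Jm) (row2 (-b1) a1) (-(row2 (-b1) a1)ᵀ)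
              (of fun j k => -(a j * b k - b j * a k))
          * fromBlocks 0 (row2 a b) (-(row2 a b)ᵀ) 0)
      - (fromBlocks (T • Jm) (row2 (reVarpi a b a2) (reVarpi b a b2))
            (-(row2 (reVarpi a b a2) (reVarpi b a b2))ᵀ) S * Em n
        - Em n * fromBlocks (T • Jm) (row2 (reVarpi a b a2) (reVarpi b a b2))
            (-(row2 (reVarpi a b a2) (reVarpi b a b2))ᵀ) S) = 0 := by
  ext (i | i) (j | j)
  all_goals first | (fin_cases i <;> fin_cases j) | fin_cases i | fin_cases j | skip
  all_goals
    simp [Em, Jm, row2, reVarpi, Matrix.mul_apply, Fintype.sum_sum_type]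
  all_goals try simp only [mul_add, add_mul, mul_sub, sub_mul, Finset.sum_sub_distrib]
  all_goals try simp only [sum_mul_mul_const, sum_const_mul_mul]
  all_goals try simp only [sum_mul_eq_dotProduct, dotProduct_comm]
  all_goals ring

theorem curvature_algebra {n : ℕ} (a b a1 b1 a2 b2 a3 b3 at' bt : Fin n → ℝ) :
    fromBlocks (((a ⬝ᵥ b2) - (b ⬝ᵥ a2)) • Jm)
        (row2 (reVarpiDeriv a b a1 b1 a3) (reVarpiDeriv b a b1 a1 b3))
        (-(row2 (reVarpiDeriv a b a1 b1 a3) (reVarpiDeriv b a b1 a1 b3))ᵀ)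
        (of fun j k => (a j * a2 k + b j * b2 k) - (a2 j * a k + b2 j * b k))
      - fromBlocks 0 (row2 at' bt) (-(row2 at' bt)ᵀ) 0
      + (fromBlocks 0 (row2 a b) (-(row2 a b)ᵀ) 0
          * fromBlocks (((a ⬝ᵥ b1) - (b ⬝ᵥ a1)) • Jm) (row2 (reVarpi a b a2) (reVarpi b a b2))
              (-(row2 (reVarpi a b a2) (reVarpi b a b2))ᵀ)
              (of fun j k => (a j * a1 k + b j * b1 k) - (a1 j * a k + b1 j * b k))
        - fromBlocks (((a ⬝ᵥ b1) - (b ⬝ᵥ a1)) • Jm) (row2 (reVarpi a b a2) (reVarpi b a b2))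
              (-(row2 (reVarpi a b a2) (reVarpi b a b2))ᵀ)
              (of fun j k => (a j * a1 k + b j * b1 k) - (a1 j * a k + b1 j * b k))
          * fromBlocks 0 (row2 a b) (-(row2 a b)ᵀ) 0)
    = -(Em n * fromBlocks ((1 / 2 * ((a ⬝ᵥ a) + (b ⬝ᵥ b))) • Jm) (row2 (-b1) a1)
            (-(row2 (-b1) a1)ᵀ) (of fun j k => -(a j * b k - b j * a k))
        - fromBlocks ((1 / 2 * ((a ⬝ᵥ a) + (b ⬝ᵥ b))) • Jm) (row2 (-b1) a1)
            (-(row2 (-b1) a1)ᵀ) (of fun j k => -(a j * b k - b j * a k)) * Em n)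
      + fromBlocks 0 (row2 (mkdvRe a b a1 b1 a3 - at') (mkdvRe b a b1 a1 b3 - bt))
          (-(row2 (mkdvRe a b a1 b1 a3 - at') (mkdvRe b a b1 a1 b3 - bt))ᵀ) 0 := by
  ext (i | i) (j | j)
  all_goals first | (fin_cases i <;> fin_cases j) | fin_cases i | fin_cases j | skip
  all_goals
    simp [Em, Jm, row2, reVarpi, reVarpiDeriv, mkdvRe, Matrix.mul_apply, Fintype.sum_sum_type]
  all_goals try simp only [mul_add, add_mul, mul_sub, sub_mul, Finset.sum_add_distrib,
    Finset.sum_sub_distrib]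
  all_goals try simp only [sum_mul_mul_const, sum_const_mul_mul, sum_mul_const_mul]
  all_goals try simp only [sum_mul_eq_dotProduct, dotProduct_comm]
  all_goals ring

theorem fromBlocks_row2_eq_zero_iff {n : ℕ} (p q : Fin n → ℝ) :
    fromBlocks (0 : Matrix (Fin 2) (Fin 2) ℝ) (row2 p q) (-(row2 p q)ᵀ) 0 = 0
      ↔ p = 0 ∧ q = 0 := by
  constructor
  · intro h
    refine ⟨funext fun k => ?_, funext fun k => ?_⟩
    · simpa [row2] using congrFun (congrFun h (Sum.inl 0)) (Sum.inr k)
    · simpa [row2] using congrFun (congrFun h (Sum.inl 1)) (Sum.inr k)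
  · rintro ⟨rfl, rfl⟩
    ext (i | i) (j | j)
    · rfl
    · fin_cases i <;> rfl
    · fin_cases j <;> simp [row2]
    · rfl

theorem dxMR_fromBlocks {n : ℕ} (A : ℝ → ℝ → Matrix (Fin 2) (Fin 2) ℝ)
    (B : ℝ → ℝ → Matrix (Fin 2) (Fin n) ℝ) (M : ℝ → ℝ → Matrix (Fin n) (Fin n) ℝ) (t x : ℝ) :
    dxMR (fun t x => fromBlocks (A t x) (B t x) (-(B t x)ᵀ) (M t x)) t x
      = fromBlocks (dxMR A t x) (dxMR B t x) (-(dxMR B t x)ᵀ) (dxMR M t x) := by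
  ext (i | i) (j | j) <;> simp [dxMR]

theorem dtMR_fromBlocks {n : ℕ} (A : ℝ → ℝ → Matrix (Fin 2) (Fin 2) ℝ)
    (B : ℝ → ℝ → Matrix (Fin 2) (Fin n) ℝ) (M : ℝ → ℝ → Matrix (Fin n) (Fin n) ℝ) (t x : ℝ) :
    dtMR (fun t x => fromBlocks (A t x) (B t x) (-(B t x)ᵀ) (M t x)) t x
      = fromBlocks (dtMR A t x) (dtMR B t x) (-(dtMR B t x)ᵀ) (dtMR M t x) := by
  ext (i | i) (j | j) <;> simp [dtMR]

theorem dxMR_smul_const {m k : Type*} {f : ℝ → ℝ → ℝ} {f' t x : ℝ}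
    (hf : HasDerivAt (fun y => f t y) f' x) (K : Matrix m k ℝ) :
    dxMR (fun t x => f t x • K) t x = f' • K := by
  ext i j
  simpa [dxMR] using (hf.mul_const (K i j)).deriv

theorem dxMR_row2 {n : ℕ} {p q : ℝ → ℝ → Fin n → ℝ} {p' q' : Fin n → ℝ} {t x : ℝ}
    (hp : ∀ k, HasDerivAt (fun y => p t y k) (p' k) x)
    (hq : ∀ k, HasDerivAt (fun y => q t y k) (q' k) x) :
    dxMR (fun t x => row2 (p t x) (q t x)) t x = row2 p' q' := by
  ext i k
  fin_cases i
  · simpa [dxMR, row2] using (hp k).deriv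
  · simpa [dxMR, row2] using (hq k).deriv

theorem dtMR_row2 {n : ℕ} {p q : ℝ → ℝ → Fin n → ℝ} {p' q' : Fin n → ℝ} {t x : ℝ}
    (hp : ∀ k, HasDerivAt (fun s => p s x k) (p' k) t)
    (hq : ∀ k, HasDerivAt (fun s => q s x k) (q' k) t) :
    dtMR (fun t x => row2 (p t x) (q t x)) t x = row2 p' q' := by
  ext i k
  fin_cases i
  · simpa [dtMR, row2] using (hp k).deriv
  · simpa [dtMR, row2] using (hq k).deriv

theorem hasDerivAt_dotProduct {n : ℕ} {p q : ℝ → Fin n → ℝ} {p' q' : Fin n → ℝ} {x : ℝ}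
    (hp : ∀ k, HasDerivAt (fun y => p y k) (p' k) x)
    (hq : ∀ k, HasDerivAt (fun y => q y k) (q' k) x) :
    HasDerivAt (fun y => p y ⬝ᵥ q y) (p' ⬝ᵥ q x + p x ⬝ᵥ q') x := by
  simp only [dotProduct, ← Finset.sum_add_distrib]
  exact HasDerivAt.fun_sum fun k _ => (hp k).mul (hq k)

theorem hasDerivAt_reVarpi {n : ℕ} {a b a2 : ℝ → Fin n → ℝ} {a1 b1 a3 : Fin n → ℝ} {x : ℝ}
    (ha : ∀ k, HasDerivAt (fun y => a y k) (a1 k) x)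
    (hb : ∀ k, HasDerivAt (fun y => b y k) (b1 k) x)
    (ha2 : ∀ k, HasDerivAt (fun y => a2 y k) (a3 k) x) (k : Fin n) :
    HasDerivAt (fun y => reVarpi (a y) (b y) (a2 y) k)
      (reVarpiDeriv (a x) (b x) a1 b1 a3 k) x := by
  refine (((ha2 k).add ((((hasDerivAt_dotProduct ha ha).const_mul (1 / 2)).add
    ((hasDerivAt_dotProduct hb hb).const_mul (3 / 2))).mul (ha k))).sub
    ((hasDerivAt_dotProduct ha hb).mul (hb k))).congr_deriv ?_
  simp only [reVarpiDeriv, Pi.add_apply, dotProduct_comm a1 (a x), dotProduct_comm b1 (b x)]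
  ring

theorem hasDerivAt_ofReal_add_I_mul {f g : ℝ → ℝ} {f' g' x : ℝ} (hf : HasDerivAt f f' x)
    (hg : HasDerivAt g g' x) :
    HasDerivAt (fun y => (f y : ℂ) + Complex.I * (g y : ℂ)) ((f' : ℂ) + Complex.I * (g' : ℂ)) x :=
  hf.ofReal_comp.add (hg.ofReal_comp.const_mul Complex.I)

theorem exists_partial_derivs {f : ℝ → ℝ → ℝ}
    (hf : ContDiff ℝ (⊤ : ℕ∞) fun q : ℝ × ℝ => f q.1 q.2) (t x : ℝ) :
    HasDerivAt (fun y => f t y) (deriv (fun y => f t y) x) x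
    ∧ HasDerivAt (fun y => deriv (fun z => f t z) y)
        (deriv (fun y => deriv (fun z => f t z) y) x) x
    ∧ HasDerivAt (fun y => deriv (fun z => deriv (fun w => f t w) z) y)
        (deriv (fun y => deriv (fun z => deriv (fun w => f t w) z) y) x) x
    ∧ HasDerivAt (fun s => f s x) (deriv (fun s => f s x) t) t := by
  have hx : ContDiff ℝ (⊤ : ℕ∞) (f t) := hf.comp (contDiff_const.prodMk contDiff_id)
  have ht : ContDiff ℝ (⊤ : ℕ∞) (fun s => f s x) := hf.comp (contDiff_id.prodMk contDiff_const)
  have hx1 := (contDiff_infty_iff_deriv.1 hx)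
  have hx2 := (contDiff_infty_iff_deriv.1 hx1.2)
  have hx3 := (contDiff_infty_iff_deriv.1 hx2.2)
  exact ⟨(hx1.1 x).hasDerivAt, (hx2.1 x).hasDerivAt, (hx3.1 x).hasDerivAt,
    ((contDiff_infty_iff_deriv.1 ht).1 t).hasDerivAt⟩

theorem dotv_eq {n : ℕ} (a b c d : Fin n → ℝ) :
    dotv (fun j => (a j : ℂ) + Complex.I * b j) (fun j => (c j : ℂ) + Complex.I * d j)
      = ((a ⬝ᵥ c - b ⬝ᵥ d : ℝ) : ℂ) + Complex.I * ((a ⬝ᵥ d + b ⬝ᵥ c : ℝ) : ℂ) := by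
  simp only [dotv, dotProduct, ← Finset.sum_sub_distrib, ← Finset.sum_add_distrib,
    Complex.ofReal_sum, Finset.mul_sum]
  refine Finset.sum_congr rfl fun j _ => ?_
  push_cast
  linear_combination (b j * d j : ℂ) * Complex.I_sq

theorem cvec_eq {n : ℕ} (a b : Fin n → ℝ) :
    cvec (fun j => (a j : ℂ) + Complex.I * b j)
      = fun j => (a j : ℂ) + Complex.I * ((-b) j : ℝ) := by
  funext j
  simp [cvec]

theorem mkdv_complex_iff {n : ℕ} (a b a1 b1 a3 b3 at' bt : Fin n → ℝ) (j : Fin n) :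
    ((at' j : ℂ) + Complex.I * bt j = (a3 j + Complex.I * b3 j)
      + (3 / 2) * (dotv (fun j => (a j : ℂ) + Complex.I * b j)
            (cvec fun j => (a j : ℂ) + Complex.I * b j) * (a1 j + Complex.I * b1 j)
          + dotv (fun j => (a1 j : ℂ) + Complex.I * b1 j)
            (cvec fun j => (a j : ℂ) + Complex.I * b j) * (a j + Complex.I * b j)
          - dotv (fun j => (a1 j : ℂ) + Complex.I * b1 j)
            (fun j => (a j : ℂ) + Complex.I * b j) * cvec (fun j => (a j : ℂ) + Complex.I * b j) j)
      + (a1 j + Complex.I * b1 j))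
    ↔ mkdvRe a b a1 b1 a3 j - at' j = 0 ∧ mkdvRe b a b1 a1 b3 j - bt j = 0 := by
  have key : (a3 j + Complex.I * b3 j)
      + (3 / 2) * (dotv (fun j => (a j : ℂ) + Complex.I * b j)
            (cvec fun j => (a j : ℂ) + Complex.I * b j) * (a1 j + Complex.I * b1 j)
          + dotv (fun j => (a1 j : ℂ) + Complex.I * b1 j)
            (cvec fun j => (a j : ℂ) + Complex.I * b j) * (a j + Complex.I * b j)
          - dotv (fun j => (a1 j : ℂ) + Complex.I * b1 j)
            (fun j => (a j : ℂ) + Complex.I * b j) * cvec (fun j => (a j : ℂ) + Complex.I * b j) j)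
      + (a1 j + Complex.I * b1 j)
      = (mkdvRe a b a1 b1 a3 j : ℂ) + Complex.I * mkdvRe b a b1 a1 b3 j := by
    rw [cvec_eq, dotv_eq, dotv_eq, dotv_eq]
    apply Complex.ext
    · simp [mkdvRe, dotProduct_comm]
      ring
    · simp [mkdvRe, dotProduct_comm]
      ring
  rw [key, Complex.ext_iff]
  simp [sub_eq_zero, eq_comm]

/-- for the +2 flow data in SO(N+1), the pair of Cartan structure
equations (zero torsion and constant curvature) holds if and only if the complex
combination v = v₁ + i·v₂ satisfies the U(N−1)-invariant complex vector mKdV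
equation ∂_t v = ∂_x³ v + (3/2)(|v|²·∂_x v + ((∂_x v)·v̄)·v − ((∂_x v)·v)·v̄) + ∂_x v. -/
theorem statement16 (n : ℕ) (hn : 1 ≤ n)
    (v1 v2 : ℝ → ℝ → Fin n → ℝ)
    (hv1 : ∀ j, ContDiff ℝ (⊤ : ℕ∞) fun q : ℝ × ℝ => v1 q.1 q.2 j)
    (hv2 : ∀ j, ContDiff ℝ (⊤ : ℕ∞) fun q : ℝ × ℝ => v2 q.1 q.2 j)
    (vc : ℝ → ℝ → Fin n → ℂ)
    (hvc : ∀ t x j, vc t x j = (v1 t x j : ℂ) + Complex.I * (v2 t x j : ℂ))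
    (ex : Matrix (Jdx n) (Jdx n) ℝ) (hex : ex = Em n)
    (ωx et ωt : ℝ → ℝ → Matrix (Jdx n) (Jdx n) ℝ)
    (hωx : ∀ t x, ωx t x = Matrix.fromBlocks 0 (row2 (v1 t x) (v2 t x))
        (-(row2 (v1 t x) (v2 t x))ᵀ) 0)
    (hpar : ℝ → ℝ → ℝ)
    (hpardef : ∀ t x, hpar t x = (1 / 2) * ∑ j, (v1 t x j ^ 2 + v2 t x j ^ 2))
    (H : ℝ → ℝ → Matrix (Fin 2) (Fin n) ℝ)
    (hHdef : ∀ t x, H t x = row2 (fun j => -deriv (fun y => v2 t y j) x)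
        (fun j => deriv (fun y => v1 t y j) x))
    (hbp : ℝ → ℝ → Matrix (Fin n) (Fin n) ℝ)
    (hbpdef : ∀ t x, hbp t x = Matrix.of fun j k =>
        -(v1 t x j * v2 t x k - v2 t x j * v1 t x k))
    (het : ∀ t x, et t x = Matrix.fromBlocks (hpar t x • Jm) (H t x)
        (-(H t x)ᵀ) (hbp t x))
    (ϖ : ℝ → ℝ → Fin n → ℂ)
    (hϖdef : ∀ t x j, ϖ t x j = deriv (fun y => dxV vc t y j) x
        + dotv (vc t x) (cvec (vc t x)) * vc t x j
        - (1 / 2) * dotv (vc t x) (vc t x) * cvec (vc t x) j)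
    (W : ℝ → ℝ → Matrix (Fin 2) (Fin n) ℝ)
    (hWdef : ∀ t x, W t x = row2 (fun j => (ϖ t x j).re) (fun j => (ϖ t x j).im))
    (Θ : ℝ → ℝ → Matrix (Fin n) (Fin n) ℝ)
    (hΘdef : ∀ t x, Θ t x = Matrix.of fun j k =>
        (starRingEnd ℂ (vc t x j) * dxV vc t x k).re
        - (starRingEnd ℂ (dxV vc t x j) * vc t x k).re)
    (θf : ℝ → ℝ → ℝ)
    (hθdef : ∀ t x, θf t x = (dotv (cvec (vc t x)) (dxV vc t x)).im)
    (hωt : ∀ t x, ωt t x = Matrix.fromBlocks (θf t x • Jm) (W t x)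
        (-(W t x)ᵀ) (Θ t x)) :
    ((∀ t x, dxMR et t x - dtMR (fun _ _ => ex) t x
        + (ωx t x * et t x - et t x * ωx t x)
        - (ωt t x * ex - ex * ωt t x) = 0) ∧
     (∀ t x, dxMR ωt t x - dtMR ωx t x
        + (ωx t x * ωt t x - ωt t x * ωx t x)
        = -(ex * et t x - et t x * ex)))
    ↔ (∀ t x j, dtV vc t x j
        = deriv (fun y => deriv (fun y2 => dxV vc t y2 j) y) x
          + (3 / 2) * (dotv (vc t x) (cvec (vc t x)) * dxV vc t x j
            + dotv (dxV vc t x) (cvec (vc t x)) * vc t x j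
            - dotv (dxV vc t x) (vc t x) * cvec (vc t x) j)
          + dxV vc t x j) := by
  obtain ⟨a1, ha1⟩ : ∃ f : ℝ → ℝ → Fin n → ℝ, f = fun t x j => deriv (fun y => v1 t y j) x :=
    ⟨_, rfl⟩
  obtain ⟨b1, hb1⟩ : ∃ f : ℝ → ℝ → Fin n → ℝ, f = fun t x j => deriv (fun y => v2 t y j) x :=
    ⟨_, rfl⟩
  obtain ⟨a2, ha2⟩ : ∃ f : ℝ → ℝ → Fin n → ℝ, f = fun t x j => deriv (fun y => a1 t y j) x :=
    ⟨_, rfl⟩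
  obtain ⟨b2, hb2⟩ : ∃ f : ℝ → ℝ → Fin n → ℝ, f = fun t x j => deriv (fun y => b1 t y j) x :=
    ⟨_, rfl⟩
  obtain ⟨a3, ha3⟩ : ∃ f : ℝ → ℝ → Fin n → ℝ, f = fun t x j => deriv (fun y => a2 t y j) x :=
    ⟨_, rfl⟩
  obtain ⟨b3, hb3⟩ : ∃ f : ℝ → ℝ → Fin n → ℝ, f = fun t x j => deriv (fun y => b2 t y j) x :=
    ⟨_, rfl⟩
  obtain ⟨at', hat⟩ : ∃ f : ℝ → ℝ → Fin n → ℝ, f = fun t x j => deriv (fun s => v1 s x j) t :=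
    ⟨_, rfl⟩
  obtain ⟨bt, hbt⟩ : ∃ f : ℝ → ℝ → Fin n → ℝ, f = fun t x j => deriv (fun s => v2 s x j) t :=
    ⟨_, rfl⟩
  have hA1 : ∀ t x j, HasDerivAt (fun y => v1 t y j) (a1 t x j) x := fun t x j => by
    subst ha1; exact (exists_partial_derivs (f := fun t x => v1 t x j) (hv1 j) t x).1
  have hB1 : ∀ t x j, HasDerivAt (fun y => v2 t y j) (b1 t x j) x := fun t x j => by
    subst hb1; exact (exists_partial_derivs (f := fun t x => v2 t x j) (hv2 j) t x).1
  have hA2 : ∀ t x j, HasDerivAt (fun y => a1 t y j) (a2 t x j) x := fun t x j => by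
    subst ha2 ha1; exact (exists_partial_derivs (f := fun t x => v1 t x j) (hv1 j) t x).2.1
  have hB2 : ∀ t x j, HasDerivAt (fun y => b1 t y j) (b2 t x j) x := fun t x j => by
    subst hb2 hb1; exact (exists_partial_derivs (f := fun t x => v2 t x j) (hv2 j) t x).2.1
  have hA3 : ∀ t x j, HasDerivAt (fun y => a2 t y j) (a3 t x j) x := fun t x j => by
    subst ha3 ha2 ha1; exact (exists_partial_derivs (f := fun t x => v1 t x j) (hv1 j) t x).2.2.1
  have hB3 : ∀ t x j, HasDerivAt (fun y => b2 t y j) (b3 t x j) x := fun t x j => by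
    subst hb3 hb2 hb1; exact (exists_partial_derivs (f := fun t x => v2 t x j) (hv2 j) t x).2.2.1
  have hAt : ∀ t x j, HasDerivAt (fun s => v1 s x j) (at' t x j) t := fun t x j => by
    subst hat; exact (exists_partial_derivs (f := fun t x => v1 t x j) (hv1 j) t x).2.2.2
  have hBt : ∀ t x j, HasDerivAt (fun s => v2 s x j) (bt t x j) t := fun t x j => by
    subst hbt; exact (exists_partial_derivs (f := fun t x => v2 t x j) (hv2 j) t x).2.2.2
  obtain rfl : vc = fun t x j => (v1 t x j : ℂ) + Complex.I * (v2 t x j : ℂ) := by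
    funext t x j; exact hvc t x j
  have hdx : dxV (fun t x j => (v1 t x j : ℂ) + Complex.I * (v2 t x j : ℂ))
      = fun t x j => (a1 t x j : ℂ) + Complex.I * (b1 t x j : ℂ) := by
    funext t x j; exact (hasDerivAt_ofReal_add_I_mul (hA1 t x j) (hB1 t x j)).deriv
  have hdx2 : ∀ t x j, deriv (fun y => (a1 t y j : ℂ) + Complex.I * (b1 t y j : ℂ)) x
      = (a2 t x j : ℂ) + Complex.I * (b2 t x j : ℂ) := fun t x j =>
    (hasDerivAt_ofReal_add_I_mul (hA2 t x j) (hB2 t x j)).deriv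
  have hdx3 : ∀ t x j, deriv (fun y => (a2 t y j : ℂ) + Complex.I * (b2 t y j : ℂ)) x
      = (a3 t x j : ℂ) + Complex.I * (b3 t x j : ℂ) := fun t x j =>
    (hasDerivAt_ofReal_add_I_mul (hA3 t x j) (hB3 t x j)).deriv
  have hdt : ∀ t x j, dtV (fun t x j => (v1 t x j : ℂ) + Complex.I * (v2 t x j : ℂ)) t x j
      = (at' t x j : ℂ) + Complex.I * (bt t x j : ℂ) := fun t x j =>
    (hasDerivAt_ofReal_add_I_mul (hAt t x j) (hBt t x j)).deriv
  simp only [hdx, hdx2] at hϖdef hΘdef hθdef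
  simp only [hdx, hdx2, hdx3, hdt]
  have hωx' : ωx = fun t x => fromBlocks 0 (row2 (v1 t x) (v2 t x))
      (-(row2 (v1 t x) (v2 t x))ᵀ) 0 := by
    funext t x; exact hωx t x
  have het' : et = fun t x => fromBlocks
      ((1 / 2 * ((v1 t x ⬝ᵥ v1 t x) + (v2 t x ⬝ᵥ v2 t x))) • Jm) (row2 (-b1 t x) (a1 t x))
      (-(row2 (-b1 t x) (a1 t x))ᵀ)
      (of fun j k => -(v1 t x j * v2 t x k - v2 t x j * v1 t x k)) := by
    funext t x
    have h1 : hpar t x = 1 / 2 * ((v1 t x ⬝ᵥ v1 t x) + (v2 t x ⬝ᵥ v2 t x)) := by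
      simp only [hpardef, dotProduct, Finset.sum_add_distrib, pow_two]
    have h2 : H t x = row2 (-b1 t x) (a1 t x) := by
      subst ha1 hb1; exact hHdef t x
    rw [het, h1, h2, hbpdef]
  have hωt' : ωt = fun t x => fromBlocks
      (((v1 t x ⬝ᵥ b1 t x) - (v2 t x ⬝ᵥ a1 t x)) • Jm)
      (row2 (reVarpi (v1 t x) (v2 t x) (a2 t x)) (reVarpi (v2 t x) (v1 t x) (b2 t x)))
      (-(row2 (reVarpi (v1 t x) (v2 t x) (a2 t x)) (reVarpi (v2 t x) (v1 t x) (b2 t x)))ᵀ)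
      (of fun j k => (v1 t x j * a1 t x k + v2 t x j * b1 t x k)
        - (a1 t x j * v1 t x k + b1 t x j * v2 t x k)) := by
    funext t x
    have h1 : θf t x = (v1 t x ⬝ᵥ b1 t x) - (v2 t x ⬝ᵥ a1 t x) := by
      rw [hθdef, cvec_eq, dotv_eq]
      simp [sub_eq_add_neg]
    have h2 : W t x = row2 (reVarpi (v1 t x) (v2 t x) (a2 t x))
        (reVarpi (v2 t x) (v1 t x) (b2 t x)) := by
      rw [hWdef]
      congr 1 <;> funext j
      · rw [hϖdef, cvec_eq, dotv_eq, dotv_eq]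
        simp [reVarpi, dotProduct_comm]
        ring
      · rw [hϖdef, cvec_eq, dotv_eq, dotv_eq]
        simp [reVarpi, dotProduct_comm]
        ring
    have h3 : Θ t x = of fun j k => (v1 t x j * a1 t x k + v2 t x j * b1 t x k)
        - (a1 t x j * v1 t x k + b1 t x j * v2 t x k) := by
      rw [hΘdef]
      ext j k
      simp
    rw [hωt, h1, h2, h3]
  have hdet : ∀ t x, dxMR et t x = fromBlocks
      (((v1 t x ⬝ᵥ a1 t x) + (v2 t x ⬝ᵥ b1 t x)) • Jm) (row2 (-b2 t x) (a2 t x))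
      (-(row2 (-b2 t x) (a2 t x))ᵀ)
      (of fun j k => -(a1 t x j * v2 t x k + v1 t x j * b1 t x k
        - b1 t x j * v1 t x k - v2 t x j * a1 t x k)) := by
    intro t x
    have hJ := ((hasDerivAt_dotProduct (hA1 t x) (hA1 t x)).add
      (hasDerivAt_dotProduct (hB1 t x) (hB1 t x))).const_mul (1 / 2)
    rw [het', dxMR_fromBlocks, dxMR_smul_const hJ,
      dxMR_row2 (p' := -b2 t x) (fun k => (hB2 t x k).neg) (hA2 t x)]
    congr 1
    · congr 1
      rw [dotProduct_comm (a1 t x), dotProduct_comm (b1 t x)]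
      ring
    · ext j k
      refine ((((hA1 t x j).mul (hB1 t x k)).sub ((hB1 t x j).mul (hA1 t x k))).neg).deriv.trans ?_
      simp only [of_apply]
      ring
  have hdωt : ∀ t x, dxMR ωt t x = fromBlocks
      (((v1 t x ⬝ᵥ b2 t x) - (v2 t x ⬝ᵥ a2 t x)) • Jm)
      (row2 (reVarpiDeriv (v1 t x) (v2 t x) (a1 t x) (b1 t x) (a3 t x))
        (reVarpiDeriv (v2 t x) (v1 t x) (b1 t x) (a1 t x) (b3 t x)))
      (-(row2 (reVarpiDeriv (v1 t x) (v2 t x) (a1 t x) (b1 t x) (a3 t x))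
        (reVarpiDeriv (v2 t x) (v1 t x) (b1 t x) (a1 t x) (b3 t x)))ᵀ)
      (of fun j k => (v1 t x j * a2 t x k + v2 t x j * b2 t x k)
        - (a2 t x j * v1 t x k + b2 t x j * v2 t x k)) := by
    intro t x
    have hJ := (hasDerivAt_dotProduct (hA1 t x) (hB2 t x)).sub
      (hasDerivAt_dotProduct (hB1 t x) (hA2 t x))
    rw [hωt', dxMR_fromBlocks, dxMR_smul_const hJ,
      dxMR_row2 (hasDerivAt_reVarpi (hA1 t x) (hB1 t x) (hA3 t x))
        (hasDerivAt_reVarpi (hB1 t x) (hA1 t x) (hB3 t x))]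
    congr 1
    · congr 1
      rw [dotProduct_comm (a1 t x)]
      ring
    · ext j k
      refine ((((hA1 t x j).mul (hA2 t x k)).add ((hB1 t x j).mul (hB2 t x k))).sub
        (((hA2 t x j).mul (hA1 t x k)).add ((hB2 t x j).mul (hB1 t x k)))).deriv.trans ?_
      simp only [of_apply]
      ring
  have hdωx : ∀ t x, dtMR ωx t x = fromBlocks 0 (row2 (at' t x) (bt t x))
      (-(row2 (at' t x) (bt t x))ᵀ) 0 := by
    intro t x
    rw [hωx', dtMR_fromBlocks (fun _ _ => 0) _ (fun _ _ => 0), dtMR_row2 (hAt t x) (hBt t x)]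
    congr 1 <;> ext <;> simp [dtMR]
  have hdex : ∀ t x, dtMR (fun _ _ => ex) t x = 0 := by
    intro t x; ext; simp [dtMR]
  have htors : ∀ t x, dxMR et t x - dtMR (fun _ _ => ex) t x
        + (ωx t x * et t x - et t x * ωx t x) - (ωt t x * ex - ex * ωt t x) = 0 := by
    intro t x
    rw [hdet, hdex, hωx', het', hωt', hex, sub_zero]
    exact torsion_algebra _ _ _ _ _ _ _ _
  rw [and_iff_right htors]
  refine forall_congr' fun t => forall_congr' fun x => ?_
  rw [hdωt, hdωx, hωx', het', hωt', hex, curvature_algebra, add_eq_left,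
    fromBlocks_row2_eq_zero_iff, funext_iff, funext_iff, ← forall_and]
  exact forall_congr' fun j => (mkdv_complex_iff _ _ _ _ _ _ _ _ j).symm
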